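/- arXiv:1901.08770 — 3 statements merged into one kernel-verified Lean document; each statement's English description precedes it below -/
import Mathlib

section
/- Let T* be a tree on a finite vertex set V with at least 3 vertices, let Σ* be a positive definite real matrix indexed by V whose conditional independence structure is given by T*, let D* be a diagonal matrix with nonnegative entries, and set Σ^o = Σ* + D*. Suppose Σ' is a positive definite matrix and D' a diagonal matrix with nonnegative entries such that Σ' + D' = Σ^o and the conditional independence structure of Σ' is given by some tree T' on V. Then there exists a set S of leaves of T* with pairwise distinct neighbors such that, with π the associated leaf-swap permutation, for all vertices i, j: i and j are adjacent in T' if and only if π(i) and π(j) are adjacent in T*. -/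
open Matrix

/-- `S` has conditional independence structure given by the simple graph `G`:
for all `i ≠ j`, the `(i,j)` entry of `S⁻¹` is nonzero exactly when `i` and `j`
are adjacent in `G`. -/
def CondIndepStruct {V : Type*} [Fintype V] [DecidableEq V]
    (S : Matrix V V ℝ) (G : SimpleGraph V) : Prop :=
  ∀ i j : V, i ≠ j → (S⁻¹ i j ≠ 0 ↔ G.Adj i j)

/-- A leaf of a graph: a vertex with exactly one neighbor. -/
def IsLeaf {V : Type*} (G : SimpleGraph V) (a : V) : Prop :=
  ∃! b : V, G.Adj a b

/-- `D` is a diagonal matrix with nonnegative entries. -/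
def IsDiagNonneg {V : Type*} (D : Matrix V V ℝ) : Prop :=
  (∀ i j : V, i ≠ j → D i j = 0) ∧ ∀ i : V, 0 ≤ D i i

/-- The graph with all edges at `k` removed. -/
def av {V : Type*} (T : SimpleGraph V) (k : V) : SimpleGraph V where
  Adj a b := T.Adj a b ∧ a ≠ k ∧ b ≠ k
  symm := ⟨fun _ _ h => ⟨h.1.symm, h.2.2, h.2.1⟩⟩
  loopless := ⟨fun a h => T.loopless.irrefl a h.1⟩

section graph
variable {V : Type*} {T : SimpleGraph V}

lemma av_adj {k a b : V} (h : T.Adj a b) (ha : a ≠ k) (hb : b ≠ k) :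
    (av T k).Reachable a b := SimpleGraph.Adj.reachable (G := av T k) ⟨h, ha, hb⟩

lemma av_step {k i j : V} (h : (av T k).Reachable i j) (hij : i ≠ j) :
    i ≠ k ∧ ∃ d, T.Adj i d ∧ d ≠ k := by
  obtain ⟨p⟩ := h
  cases p with
  | nil => exact absurd rfl hij
  | cons h p => exact ⟨h.2.1, _, h.1, h.2.2⟩

lemma av_iso {k j : V} (h : k ≠ j) : ¬ (av T k).Reachable k j :=
  fun h' => (av_step h' h).1 rfl

lemma av_walk {k b j : V} (p : T.Walk b j) (h : k ∉ p.support) : (av T k).Reachable b j := by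
  induction p with
  | nil => exact SimpleGraph.Reachable.refl _
  | cons e p ih =>
    simp only [SimpleGraph.Walk.support_cons, List.mem_cons, not_or] at h
    refine (av_adj e (Ne.symm h.1) ?_).trans (ih h.2)
    rintro rfl
    exact h.2 p.start_mem_support

lemma tree_ind (hT : T.IsTree) (j : V) (P : V → Prop) (h0 : P j)
    (hs : ∀ k b, T.Adj k b → (av T k).Reachable b j → P b → P k) (k : V) : P k := by
  obtain ⟨p, hp⟩ := hT.connected.exists_isPath k j
  induction p with
  | nil => exact h0
  | cons e p ih =>
    rw [SimpleGraph.Walk.cons_isPath_iff] at hp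
    exact hs _ _ e (av_walk p hp.2) (ih h0 hs hp.1)

lemma tree_nbr (hT : T.IsTree) {k j : V} (h : k ≠ j) :
    ∃ b, T.Adj k b ∧ (av T k).Reachable b j := by
  revert h
  refine tree_ind hT j (fun k => k ≠ j → ∃ b, T.Adj k b ∧ (av T k).Reachable b j) ?_ ?_ k
  · intro h; exact absurd rfl h
  · intro k b h1 h2 _ _
    exact ⟨b, h1, h2⟩

lemma av_bridge (hT : T.IsTree) {k b i : V} (h : T.Adj k b) (h1 : (av T k).Reachable b i) :
    ¬ (av T b).Reachable k i := by
  intro h2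
  have hb := SimpleGraph.isAcyclic_iff_forall_adj_isBridge.1 hT.isAcyclic h
  rw [SimpleGraph.isBridge_iff] at hb
  apply hb
  refine (h2.mono ?_).trans (h1.mono ?_).symm
  · intro x y hxy
    obtain ⟨e, hx, hy⟩ := hxy
    rw [SimpleGraph.deleteEdges_adj]
    refine ⟨e, ?_⟩
    simp only [Set.mem_singleton_iff, Sym2.eq_iff]
    tauto
  · intro x y hxy
    obtain ⟨e, hx, hy⟩ := hxy
    rw [SimpleGraph.deleteEdges_adj]
    refine ⟨e, ?_⟩
    simp only [Set.mem_singleton_iff, Sym2.eq_iff]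
    tauto

/-- distinct neighbours of `k` are separated by `k` -/
lemma av_nbrs (hT : T.IsTree) {k l b : V} (h : T.Adj k l) (h' : T.Adj k b) (hl : l ≠ b) :
    ¬ (av T k).Reachable l b := fun h1 =>
  av_bridge hT h h1 (av_adj h' h.ne (Ne.symm hl))

lemma nonleaf_nbrs (hT : T.IsTree) {k x : V} (hx : k ≠ x) (h : ¬ IsLeaf T k) :
    ∃ a b, T.Adj k a ∧ T.Adj k b ∧ a ≠ b := by
  obtain ⟨a, ha, _⟩ := tree_nbr hT hx
  by_contra hc
  push Not at hc
  exact h ⟨a, ha, fun y hy => (hc _ _ ha hy).symm⟩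

lemma leaf_iso {a b j : V} (ha : IsLeaf T a) (hab : T.Adj a b) (hj : a ≠ j) :
    ¬ (av T b).Reachable a j := by
  intro h
  obtain ⟨_, d, hd, hdb⟩ := av_step h hj
  exact hdb (ha.unique hd hab)

lemma leaf_nonleaf (hT : T.IsTree) {a b j : V} (hja : j ≠ a) (hjb : j ≠ b) (ha : IsLeaf T a)
    (hab : T.Adj a b) : ¬ IsLeaf T b := by
  intro hb
  obtain ⟨c, hc, hcj⟩ := tree_nbr hT (Ne.symm hjb)
  obtain rfl := hb.unique hc hab.symm
  exact leaf_iso ha hab hja.symm hcj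

lemma adj_char (hT : T.IsTree) (i j : V) :
    T.Adj i j ↔ i ≠ j ∧ ∀ k, ¬ IsLeaf T k → k ≠ i → k ≠ j → (av T k).Reachable i j := by
  constructor
  · intro h
    exact ⟨h.ne, fun k _ h1 h2 => av_adj h h1.symm h2.symm⟩
  · rintro ⟨hij, h⟩
    obtain ⟨b, hb, hbj⟩ := tree_nbr hT hij
    by_cases hbe : b = j
    · exact hbe ▸ hb
    · exfalso
      obtain ⟨_, d, hd, hdi⟩ := av_step hbj hbe
      refine av_bridge hT hb hbj (h b ?_ hb.ne.symm hbe)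
      intro hl
      exact hdi (hl.unique hd hb.symm)
end graph

section alg
variable {V : Type*} [Fintype V] [DecidableEq V] {T : SimpleGraph V} {M : Matrix V V ℝ}

lemma M_symm (hM : M.PosDef) (i j : V) : M i j = M j i := by
  have := hM.1.apply i j
  simpa using this.symm

lemma inv_mul_app (hM : M.PosDef) (i j : V) :
    ∑ l, M⁻¹ i l * M l j = if i = j then 1 else 0 := by
  have h := Matrix.nonsing_inv_mul M (isUnit_iff_ne_zero.2 hM.det_pos.ne')
  have h2 := congrFun (congrFun h i) j
  rwa [Matrix.mul_apply, Matrix.one_apply] at h2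

lemma sep_mul (hM : M.PosDef) (hCI : CondIndepStruct M T) {i k j : V}
    (h : ¬ (av T k).Reachable i j) : M i j * M k k = M i k * M k j := by
  classical
  by_cases hik : i = k
  · subst hik; ring
  set x : V → ℝ := fun l => M l j * M k k - M l k * M k j with hx
  set u : V → ℝ := fun l => if (av T k).Reachable i l then x l else 0 with hu
  have hK : ∀ l, (av T k).Reachable i l → (M⁻¹ *ᵥ u) l = 0 := by
    intro l hl
    have hlk : l ≠ k := by
      rintro rfl
      exact av_iso (Ne.symm hik) hl.symm
    have hlj : l ≠ j := by
      rintro rfl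
      exact h hl
    have e1 : (M⁻¹ *ᵥ u) l = ∑ p, M⁻¹ l p * x p := by
      simp only [Matrix.mulVec, dotProduct]
      refine Finset.sum_congr rfl fun p _ => ?_
      by_cases hp : (av T k).Reachable i p
      · simp [hu, hp]
      · by_cases hpk : p = k
        · subst hpk
          have : x p = 0 := by simp only [hx]; ring
          simp [hu, hp, this]
        · have hlp : l ≠ p := by rintro rfl; exact hp hl
          have : M⁻¹ l p = 0 := by
            by_contra hne
            exact hp (hl.trans (av_adj ((hCI l p hlp).1 hne) hlk hpk))
          simp [this]
    rw [e1]
    have e2 : ∑ p, M⁻¹ l p * x p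
        = (∑ p, M⁻¹ l p * M p j) * M k k - (∑ p, M⁻¹ l p * M p k) * M k j := by
      rw [Finset.sum_mul, Finset.sum_mul, ← Finset.sum_sub_distrib]
      refine Finset.sum_congr rfl fun p _ => ?_
      simp only [hx]; ring
    rw [e2, inv_mul_app hM, inv_mul_app hM]
    simp [hlk, hlj]
  have hu0 : u = 0 := by
    by_contra hne
    have := hM.inv.dotProduct_mulVec_pos hne
    have h0 : star u ⬝ᵥ (M⁻¹ *ᵥ u) = 0 := by
      simp only [dotProduct]
      refine Finset.sum_eq_zero fun l _ => ?_
      by_cases hl : (av T k).Reachable i l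
      · rw [hK l hl, mul_zero]
      · simp [hu, hl]
    linarith
  have := congrFun hu0 i
  simp only [hu, SimpleGraph.Reachable.refl, if_true, hx, Pi.zero_apply] at this
  linarith

lemma adj_ne (hT : T.IsTree) (hM : M.PosDef) (hCI : CondIndepStruct M T) {k b : V}
    (h : T.Adj k b) : M k b ≠ 0 := by
  intro h0
  have hs := inv_mul_app hM k b
  rw [if_neg h.ne, Finset.sum_eq_single b] at hs
  · have h1 := (hCI k b h.ne).2 h
    have h2 : 0 < M b b := hM.diag_pos
    exact (mul_ne_zero h1 h2.ne') hs
  · intro l _ hlb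
    by_cases hlk : l = k
    · rw [hlk, h0, mul_zero]
    · by_cases hz : M⁻¹ k l = 0
      · rw [hz, zero_mul]
      · have ha := (hCI k l (Ne.symm hlk)).1 hz
        have := sep_mul hM hCI (av_nbrs hT ha h hlb)
        rw [h0, mul_zero] at this
        have h2 : 0 < M k k := hM.diag_pos
        rcases mul_eq_zero.1 this with h3 | h3
        · rw [h3, mul_zero]
        · exact absurd h3 h2.ne'
  · simp

lemma all_ne (hT : T.IsTree) (hM : M.PosDef) (hCI : CondIndepStruct M T) (k j : V) :
    M k j ≠ 0 := by
  refine tree_ind hT j (fun k => M k j ≠ 0) (hM.diag_pos).ne' ?_ k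
  intro k b h h1 h2 h0
  have := sep_mul hM hCI (av_bridge hT h h1)
  rw [h0, zero_mul] at this
  exact mul_ne_zero (adj_ne hT hM hCI h) h2 this.symm

lemma sq_lt (hM : M.PosDef) {k b : V} (h : k ≠ b) : M k b * M k b < M k k * M b b := by
  have hinj : Function.Injective ![k, b] := by
    intro x y hxy
    fin_cases x <;> fin_cases y <;> simp_all
  have := (hM.submatrix hinj).det_pos
  rw [Matrix.det_fin_two] at this
  simp at this
  rw [M_symm hM b k] at this
  linarith

/-- The ratio. -/
noncomputable def fr (M : Matrix V V ℝ) (k i j : V) : ℝ := M i k * M k j / M i j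

lemma fr_step (hT : T.IsTree) (hM : M.PosDef) (hCI : CondIndepStruct M T) {k b i j : V}
    (hi : ¬ (av T b).Reachable k i) (hj : ¬ (av T b).Reachable k j) :
    fr M k i j = (M k b / M b b) ^ 2 * fr M b i j := by
  have h1 := sep_mul hM hCI hi
  have h2 := sep_mul hM hCI hj
  have h3 := all_ne hT hM hCI b b
  have h4 := all_ne hT hM hCI i j
  unfold fr
  rw [M_symm hM i k, M_symm hM i b, eq_div_of_mul_eq h3 h1, eq_div_of_mul_eq h3 h2]
  field_simp

lemma fr_sep (hT : T.IsTree) (hM : M.PosDef) (hCI : CondIndepStruct M T) {k i j : V}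
    (h : ¬ (av T k).Reachable i j) : fr M k i j = M k k := by
  have := sep_mul hM hCI h
  have h4 := all_ne hT hM hCI i j
  unfold fr
  rw [← this]
  field_simp

lemma fr_aux (hM : M.PosDef) {k b : V} (h : k ≠ b) {c : ℝ} (hc : c ≤ M b b) :
    (M k b / M b b) ^ 2 * c < M k k := by
  have h2 : 0 < M b b := hM.diag_pos
  calc (M k b / M b b) ^ 2 * c ≤ (M k b / M b b) ^ 2 * M b b := by gcongr
    _ = M k b * M k b / M b b := by field_simp
    _ < M k k := by rw [div_lt_iff₀ h2]; exact sq_lt hM h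

lemma fr_le (hT : T.IsTree) (hM : M.PosDef) (hCI : CondIndepStruct M T) (k i : V) :
    ∀ j, fr M k i j ≤ M k k := by
  refine tree_ind hT i (fun k => ∀ j, fr M k i j ≤ M k k) ?_ ?_ k
  · intro j
    have := all_ne hT hM hCI i j
    unfold fr
    apply le_of_eq
    field_simp
  · intro k b h h1 ih j
    by_cases hr : (av T k).Reachable i j
    · rw [fr_step hT hM hCI (av_bridge hT h h1) (av_bridge hT h (h1.trans hr))]
      exact (fr_aux hM h.ne (ih j)).le
    · exact (fr_sep hT hM hCI hr).le

lemma fr_eq_iff (hT : T.IsTree) (hM : M.PosDef) (hCI : CondIndepStruct M T) {k i j : V}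
    (hij : i ≠ j) : fr M k i j = M k k ↔ ¬ (av T k).Reachable i j := by
  refine ⟨fun he hr => ?_, fr_sep hT hM hCI⟩
  obtain ⟨b, h, h1⟩ := tree_nbr hT (av_step hr hij).1.symm
  rw [fr_step hT hM hCI (av_bridge hT h h1) (av_bridge hT h (h1.trans hr))] at he
  exact (fr_aux hM h.ne (fr_le hT hM hCI b i j)).ne he

/-- The ratio at `k` is maximal at the pair `i, j`. -/
def Nr (M : Matrix V V ℝ) (k i j : V) : Prop :=
  ∀ i' j', i' ≠ k → j' ≠ k → i' ≠ j' → fr M k i' j' ≤ fr M k i j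

lemma Nr_nonleaf (hT : T.IsTree) (hM : M.PosDef) (hCI : CondIndepStruct M T) {k i j : V}
    (hk : ¬ IsLeaf T k) (hik : i ≠ k) (hij : i ≠ j) :
    Nr M k i j ↔ ¬ (av T k).Reachable i j := by
  rw [← fr_eq_iff hT hM hCI hij]
  constructor
  · intro h
    obtain ⟨a, b, ha, hb, hab⟩ := nonleaf_nbrs hT hik.symm hk
    have h1 := h a b ha.ne.symm hb.ne.symm hab
    rw [fr_sep hT hM hCI (av_nbrs hT ha hb hab)] at h1
    exact le_antisymm (fr_le hT hM hCI k i j) h1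
  · intro h i' j' _ _ _
    rw [h]
    exact fr_le hT hM hCI k i' j'

lemma Nr_leaf (hT : T.IsTree) (hcard : 3 ≤ Fintype.card V) (hM : M.PosDef)
    (hCI : CondIndepStruct M T) {k b i j : V}
    (hk : IsLeaf T k) (hkb : T.Adj k b) (hik : i ≠ k) (hjk : j ≠ k) (hij : i ≠ j) :
    Nr M k i j ↔ ¬ (av T b).Reachable i j := by
  rw [← fr_eq_iff hT hM hCI hij]
  have hc : 0 < (M k b / M b b) ^ 2 := by
    have := all_ne hT hM hCI k b
    have := all_ne hT hM hCI b b
    positivity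
  have hst : ∀ i' j', i' ≠ k → j' ≠ k → fr M k i' j' = (M k b / M b b) ^ 2 * fr M b i' j' :=
    fun i' j' h1 h2 => fr_step hT hM hCI (leaf_iso hk hkb h1.symm) (leaf_iso hk hkb h2.symm)
  constructor
  · intro h
    obtain ⟨c, hc1, hc2⟩ : ∃ c, c ≠ k ∧ c ≠ b := by
      by_contra hcon
      push Not at hcon
      have : (Finset.univ : Finset V) ⊆ {k, b} := by
        intro c _
        simp only [Finset.mem_insert, Finset.mem_singleton]
        by_cases h : c = k
        · exact Or.inl h
        · exact Or.inr (hcon c h)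
      have := (Finset.card_le_card this).trans Finset.card_le_two
      rw [Finset.card_univ] at this
      omega
    have h1 := h b c hkb.ne.symm hc1 hc2.symm
    rw [hst b c hkb.ne.symm hc1, hst i j hik hjk, fr_sep hT hM hCI (av_iso hc2.symm)] at h1
    exact le_antisymm (fr_le hT hM hCI b i j) (le_of_mul_le_mul_left h1 hc)
  · intro h i' j' h1 h2 _
    rw [hst i j hik hjk, hst i' j' h1 h2, h]
    exact mul_le_mul_of_nonneg_left (fr_le hT hM hCI b i' j') hc.le

lemma Nr_congr {M M' : Matrix V V ℝ} (h : ∀ i j, i ≠ j → M i j = M' i j) {k i j : V}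
    (hik : i ≠ k) (hjk : j ≠ k) (hij : i ≠ j) : Nr M k i j ↔ Nr M' k i j := by
  have hf : ∀ i j, i ≠ k → j ≠ k → i ≠ j → fr M k i j = fr M' k i j := by
    intro i j h1 h2 h3
    unfold fr
    rw [h i k h1, h k j h2.symm, h i j h3]
  unfold Nr
  refine forall_congr' fun i' => forall_congr' fun j' => forall_congr' fun h1 =>
    forall_congr' fun h2 => forall_congr' fun h3 => ?_
  rw [hf i' j' h1 h2 h3, hf i j hik hjk hij]
end alg

/-- The combinatorial content of the ratios: `N` records the separation structure of `T`. -/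
structure Rec {V : Type*} (T : SimpleGraph V) (N : V → V → V → Prop) : Prop where
  tree : T.IsTree
  big : ∀ a b : V, ∃ c, c ≠ a ∧ c ≠ b
  nonleaf : ∀ k i j, ¬ IsLeaf T k → i ≠ k → j ≠ k → i ≠ j →
    (N k i j ↔ ¬ (av T k).Reachable i j)
  leaf : ∀ k b i j, IsLeaf T k → T.Adj k b → i ≠ k → j ≠ k → i ≠ j →
    (N k i j ↔ ¬ (av T b).Reachable i j)

/-- `a` is a leaf of `T` at `b`, with the roles exchanged in the second tree. -/
def Sw {V : Type*} (T T' : SimpleGraph V) (a b : V) : Prop :=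
  T.Adj a b ∧ T'.Adj a b ∧ IsLeaf T a ∧ ¬ IsLeaf T' a ∧ IsLeaf T' b ∧ ¬ IsLeaf T b

section comb
variable {V : Type*} {T T' : SimpleGraph V} {N : V → V → V → Prop}

lemma sw_of (h : Rec T N) (h' : Rec T' N) {a b : V} (ha : IsLeaf T a) (ha' : ¬ IsLeaf T' a)
    (hab : T.Adj a b) : Sw T T' a b := by
  have key : ∀ j, T'.Adj b j → j = a := by
    intro j hj
    by_contra hja
    have h1 := (h.leaf a b b j ha hab hab.ne.symm hja hj.ne).2 (av_iso hj.ne)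
    exact (h'.nonleaf a b j ha' hab.ne.symm hja hj.ne).1 h1 (av_adj hj hab.ne.symm hja)
  obtain ⟨c, hc, _⟩ := tree_nbr h'.tree hab.ne.symm
  obtain rfl := key c hc
  obtain ⟨d, hd1, hd2⟩ := h.big c b
  exact ⟨hab, hc.symm, ha, ha', ⟨c, hc, key⟩, leaf_nonleaf h.tree hd1 hd2 ha hab⟩

lemma main_comb (h : Rec T N) (h' : Rec T' N) :
    ∃ S : Set V, (∀ a ∈ S, IsLeaf T a) ∧
      (∀ a ∈ S, ∀ a' ∈ S, a ≠ a' →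
        ∀ b b' : V, T.Adj a b → T.Adj a' b' → b ≠ b') ∧
      ∃ π : Equiv.Perm V,
        (∀ a ∈ S, T.Adj a (π a)) ∧
        (∀ v : V, π (π v) = v) ∧
        (∀ v : V, π v ≠ v → v ∈ S ∨ ∃ a ∈ S, T.Adj a v) ∧
        ∀ i j : V, T'.Adj i j ↔ T.Adj (π i) (π j) := by
  classical
  have ex : ∀ v, ∃ w, Sw T T' v w ∨ Sw T T' w v ∨ (w = v ∧ (IsLeaf T v ↔ IsLeaf T' v)) := by
    intro v
    by_cases h1 : IsLeaf T v <;> by_cases h2 : IsLeaf T' v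
    · exact ⟨v, by tauto⟩
    · obtain ⟨b, hb, _⟩ := id h1
      exact ⟨b, Or.inl (sw_of h h' h1 h2 hb)⟩
    · obtain ⟨b, hb, _⟩ := id h2
      obtain ⟨e1, e2, e3, e4, e5, e6⟩ := sw_of h' h h2 h1 hb
      exact ⟨b, Or.inr (Or.inl ⟨e2.symm, e1.symm, e5, e6, e3, e4⟩)⟩
    · exact ⟨v, by tauto⟩
  choose σ hσ using ex
  have s1 : ∀ v w, Sw T T' v w → σ v = w := by
    intro v w ⟨a1, a2, a3, a4, a5, a6⟩
    rcases hσ v with ⟨b1, b2, b3, b4, b5, b6⟩ | ⟨b1, b2, b3, b4, b5, b6⟩ | b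
    · exact a3.unique b1 a1
    · exact absurd a3 b6
    · tauto
  have s2 : ∀ v w, Sw T T' w v → σ v = w := by
    intro v w ⟨a1, a2, a3, a4, a5, a6⟩
    rcases hσ v with ⟨b1, b2, b3, b4, b5, b6⟩ | ⟨b1, b2, b3, b4, b5, b6⟩ | b
    · exact absurd b3 a6
    · exact a5.unique b2.symm a2.symm
    · tauto
  have inv : Function.Involutive σ := by
    intro v
    rcases hσ v with b | b | b
    · exact s2 _ _ b
    · exact s1 _ _ b
    · rw [b.1, b.1]
  have hmove : ∀ v, σ v ≠ v → T.Adj v (σ v) := by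
    intro v hv
    rcases hσ v with b | b | b
    · exact b.1
    · exact b.1.symm
    · exact absurd b.1 hv
  have hleaf : ∀ v, IsLeaf T (σ v) ↔ IsLeaf T' v := by
    intro v
    rcases hσ v with ⟨b1, b2, b3, b4, b5, b6⟩ | ⟨b1, b2, b3, b4, b5, b6⟩ | b
    · tauto
    · tauto
    · rw [b.1]; exact b.2
  have hne : ∀ {v w}, v ≠ w → σ v ≠ σ w := fun hvw => inv.injective.ne hvw
  have equi : ∀ m i j, ¬ IsLeaf T' m → m ≠ i → m ≠ j → i ≠ j →
      ((av T' m).Reachable i j ↔ (av T (σ m)).Reachable (σ i) (σ j)) := by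
    intro m i j hm hi hj hij
    rw [← not_iff_not, ← h'.nonleaf m i j hm hi.symm hj.symm hij]
    have hr : ∀ i b, i ≠ b → σ i ≠ b → (av T b).Reachable i (σ i) := by
      intro i b h1 h2
      by_cases hi : σ i = i
      · rw [hi]
      · exact av_adj (hmove i (hi)) h1 h2
    rcases hσ m with hs | hs | hs
    · obtain ⟨b1, b2, b3, b4, b5, b6⟩ := id hs
      have hsm := s2 _ _ hs
      rw [h.leaf m (σ m) i j b3 b1 hi.symm hj.symm hij]
      by_cases hib : i = σ m
      · rw [hib, hsm]
        have hj2 : m ≠ σ j := by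
          rw [← hsm]; apply hne; rw [← hib]; exact hij
        exact iff_of_true (av_iso (hib ▸ hij)) (leaf_iso b3 b1 hj2)
      · by_cases hjb : j = σ m
        · rw [hjb, hsm]
          have hi2 : m ≠ σ i := by
            rw [← hsm]; apply hne; rw [← hjb]; exact hij.symm
          refine iff_of_true (fun hh => av_iso (Ne.symm hib) hh.symm) (fun hh => leaf_iso b3 b1 hi2 hh.symm)
        · have e1 := hr i (σ m) hib (hne hi.symm)
          have e2 := hr j (σ m) hjb (hne hj.symm)
          exact not_congr ⟨fun x => e1.symm.trans (x.trans e2), fun x => e1.trans (x.trans e2.symm)⟩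
    · exact absurd hs.2.2.2.2.1 hm
    · have hm2 : ¬ IsLeaf T m := fun x => hm (hs.2.1 x)
      rw [h.nonleaf m i j hm2 hi.symm hj.symm hij, hs.1]
      have e1 := hr i m hi.symm (fun x => hne hi.symm (x.trans hs.1.symm))
      have e2 := hr j m hj.symm (fun x => hne hj.symm (x.trans hs.1.symm))
      exact not_congr ⟨fun x => e1.symm.trans (x.trans e2), fun x => e1.trans (x.trans e2.symm)⟩
  refine ⟨{a | IsLeaf T a ∧ ¬ IsLeaf T' a}, fun a ha => ha.1, ?_, inv.toPerm σ, ?_, inv, ?_, ?_⟩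
  · rintro a ⟨ha, ha'⟩ c ⟨hc, hc'⟩ hac b b' hb hb' rfl
    have e1 := sw_of h h' ha ha' hb
    have e2 := sw_of h h' hc hc' hb'
    exact hac (e1.2.2.2.2.1.unique e1.2.1.symm e2.2.1.symm)
  · rintro a ⟨ha, ha'⟩
    apply hmove
    obtain ⟨b, hb, _⟩ := id ha
    rw [s1 _ _ (sw_of h h' ha ha' hb)]
    exact hb.ne.symm
  · intro v hv
    rcases hσ v with b | b | b
    · exact Or.inl ⟨b.2.2.1, b.2.2.2.1⟩
    · exact Or.inr ⟨σ v, ⟨b.2.2.1, b.2.2.2.1⟩, b.1⟩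
    · exact absurd b.1 hv
  · intro i j
    simp only [Function.Involutive.coe_toPerm]
    rw [adj_char h'.tree, adj_char h.tree]
    constructor
    · rintro ⟨hij, hk⟩
      refine ⟨hne hij, fun k k1 k2 k3 => ?_⟩
      have hki : σ k ≠ i := fun x => k2 (by rw [← x, inv])
      have hkj : σ k ≠ j := fun x => k3 (by rw [← x, inv])
      have hl : ¬ IsLeaf T' (σ k) := by rw [← hleaf, inv]; exact k1
      have := (equi (σ k) i j hl hki hkj hij).1 (hk _ hl hki hkj)
      rwa [inv] at this
    · rintro ⟨hij, hk⟩
      have hij' : i ≠ j := fun x => hij (by rw [x])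
      refine ⟨hij', fun m m1 m2 m3 => ?_⟩
      exact (equi m i j m1 m2 m3 hij').2 (hk _ (by rwa [hleaf]) (hne m2) (hne m3))
end comb

lemma rec_of {V : Type*} [Fintype V] [DecidableEq V] {T : SimpleGraph V} (hT : T.IsTree)
    (hcard : 3 ≤ Fintype.card V) {M : Matrix V V ℝ} (hM : M.PosDef) (hCI : CondIndepStruct M T) :
    Rec T (Nr M) where
  tree := hT
  big := by
    intro a b
    by_contra hcon
    push Not at hcon
    have : (Finset.univ : Finset V) ⊆ {a, b} := by
      intro c _
      simp only [Finset.mem_insert, Finset.mem_singleton]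
      by_cases h : c = a
      · exact Or.inl h
      · exact Or.inr (hcon c h)
    have := (Finset.card_le_card this).trans Finset.card_le_two
    rw [Finset.card_univ] at this
    omega
  nonleaf := fun _ _ _ hk hi _ hij => Nr_nonleaf hT hM hCI hk hi hij
  leaf := fun _ _ _ _ hk hb hi hj hij => Nr_leaf hT hcard hM hCI hk hb hi hj hij

theorem stmt_1 {V : Type*} [Fintype V] [DecidableEq V]
    (Tstar : SimpleGraph V) (hTree : Tstar.IsTree) (hcard : 3 ≤ Fintype.card V)
    (Sig : Matrix V V ℝ) (hPD : Sig.PosDef) (hCI : CondIndepStruct Sig Tstar)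
    (Dstar : Matrix V V ℝ) (hDstar : IsDiagNonneg Dstar)
    (Sig' : Matrix V V ℝ) (hPD' : Sig'.PosDef)
    (D' : Matrix V V ℝ) (hD' : IsDiagNonneg D')
    (hsum : Sig' + D' = Sig + Dstar)
    (T' : SimpleGraph V) (hTree' : T'.IsTree) (hCI' : CondIndepStruct Sig' T') :
    ∃ S : Set V, (∀ a ∈ S, IsLeaf Tstar a) ∧
      (∀ a ∈ S, ∀ a' ∈ S, a ≠ a' →
        ∀ b b' : V, Tstar.Adj a b → Tstar.Adj a' b' → b ≠ b') ∧
      ∃ π : Equiv.Perm V,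
        (∀ a ∈ S, Tstar.Adj a (π a)) ∧
        (∀ v : V, π (π v) = v) ∧
        (∀ v : V, π v ≠ v → v ∈ S ∨ ∃ a ∈ S, Tstar.Adj a v) ∧
        ∀ i j : V, T'.Adj i j ↔ Tstar.Adj (π i) (π j) := by
  have hoff : ∀ i j, i ≠ j → Sig i j = Sig' i j := by
    intro i j hij
    have := congrFun (congrFun hsum i) j
    simp only [Matrix.add_apply, hDstar.1 i j hij, hD'.1 i j hij, add_zero] at this
    exact this.symm
  have h := rec_of hTree hcard hPD hCI
  have h' := rec_of hTree' hcard hPD' hCI'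
  refine main_comb h ⟨hTree', h.big, ?_, ?_⟩
  · intro k i j hk hi hj hij
    rw [Nr_congr hoff hi hj hij]
    exact h'.nonleaf k i j hk hi hj hij
  · intro k b i j hk hb hi hj hij
    rw [Nr_congr hoff hi hj hij]
    exact h'.leaf k b i j hk hb hi hj hij
end

section
/- Let T* be a tree on a finite vertex set V with at least 3 vertices, let Σ* be a positive definite real matrix indexed by V whose conditional independence structure is given by T*, let λ denote the smallest eigenvalue of Σ*, let D* be a diagonal matrix with nonnegative entries every diagonal entry of which is strictly less than λ, and set Σ^o = Σ* + D*. If Σ' is positive definite with xᵀΣ'x ≥ λ‖x‖² for all vectors x, D' is a diagonal matrix with nonnegative entries, Σ' + D' = Σ^o, and the conditional independence structure of Σ' is given by a tree T', then T' = T*, i.e., T' and T* have exactly the same edges. -/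
open Matrix

def SepV {V : Type*} (G : SimpleGraph V) (m i k : V) : Prop :=
  ∀ w : G.Walk i k, m ∈ w.support

def InternalV {V : Type*} (G : SimpleGraph V) (b : V) : Prop :=
  ∃ i k : V, i ≠ b ∧ k ≠ b ∧ SepV G b i k

theorem SepV.symm {V : Type*} {G : SimpleGraph V} {m i k : V} (h : SepV G m i k) :
    SepV G m k i := by
  intro w
  have := h w.reverse
  simpa using this

theorem edge_sep {V : Type*} {G : SimpleGraph V} (hG : G.IsTree) {p q : V} (h : G.Adj p q)
    (k : V) : SepV G q p k ∨ SepV G p q k := by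
  by_contra hcon
  simp only [SepV, not_or, not_forall] at hcon
  obtain ⟨⟨w1, h1⟩, ⟨w2, h2⟩⟩ := hcon
  have hb := (SimpleGraph.isAcyclic_iff_forall_adj_isBridge.1 hG.isAcyclic) h
  rw [SimpleGraph.isBridge_iff_forall_walk_mem_edges] at hb
  have := hb (w1.append w2.reverse)
  rw [SimpleGraph.Walk.edges_append, List.mem_append] at this
  rcases this with h3 | h3
  · exact h1 (SimpleGraph.Walk.snd_mem_support_of_mem_edges _ h3)
  · rw [SimpleGraph.Walk.edges_reverse, List.mem_reverse] at h3
    exact h2 (SimpleGraph.Walk.fst_mem_support_of_mem_edges _ h3)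

section
variable {V : Type*} [Fintype V] [DecidableEq V]

theorem sigma_symm {S : Matrix V V ℝ} (hS : S.PosDef) (i j : V) : S i j = S j i := by
  have := hS.1.apply i j
  simpa using this.symm

theorem sep_eq {S : Matrix V V ℝ} {G : SimpleGraph V} (hS : S.PosDef)
    (hC : CondIndepStruct S G) {m i k : V} (h : SepV G m i k) :
    S i k * S m m = S i m * S m k := by
  classical
  by_cases hmi : m = i
  · subst hmi; ring
  let A : Set V := {u | ∃ w : G.Walk i u, m ∉ w.support}
  have hiA : i ∈ A := ⟨SimpleGraph.Walk.nil, by simpa using hmi⟩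
  have hkA : k ∉ A := fun ⟨w, hw⟩ => hw (h w)
  have hmA : m ∉ A := fun ⟨w, hw⟩ => hw (by simp)
  have hK : ∀ u ∈ A, ∀ v, v ∉ A → v ≠ m → S⁻¹ u v = 0 := by
    rintro u ⟨w, hw⟩ v hv hvm
    by_contra hne
    have huv : u ≠ v := fun e => hv (e ▸ ⟨w, hw⟩)
    have hadj := (hC u v huv).1 hne
    apply hv
    refine ⟨w.concat hadj, ?_⟩
    rw [SimpleGraph.Walk.support_concat]
    simp [hw, Ne.symm hvm]
  have hdet : IsUnit S.det := by
    have := hS.det_pos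
    exact isUnit_iff_ne_zero.2 this.ne'
  have hinv : S⁻¹ * S = 1 := Matrix.nonsing_inv_mul S hdet
  have hinv' : ∀ a b, ∑ c, S⁻¹ a c * S c b = if a = b then 1 else 0 := by
    intro a b
    have := congrFun (congrFun hinv a) b
    rwa [Matrix.mul_apply, Matrix.one_apply] at this
  let x : V → ℝ := fun u => S u k * S m m - S u m * S m k
  let y : V → ℝ := fun u => if u ∈ A then x u else 0
  have hx : ∀ u ∈ A, ∑ v, S⁻¹ u v * x v = 0 := by
    intro u hu
    have huk : u ≠ k := fun e => hkA (e ▸ hu)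
    have hum : u ≠ m := fun e => hmA (e ▸ hu)
    have h1 := hinv' u k
    have h2 := hinv' u m
    rw [if_neg huk] at h1
    rw [if_neg hum] at h2
    calc ∑ v, S⁻¹ u v * x v
        = (∑ v, S⁻¹ u v * S v k) * S m m - (∑ v, S⁻¹ u v * S v m) * S m k := by
          rw [Finset.sum_mul, Finset.sum_mul, ← Finset.sum_sub_distrib]
          exact Finset.sum_congr rfl fun v _ => by simp only [x]; ring
      _ = 0 := by rw [h1, h2]; ring
  have hy : ∀ u ∈ A, (S⁻¹ *ᵥ y) u = 0 := by
    intro u hu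
    rw [← hx u hu]
    simp only [Matrix.mulVec, dotProduct]
    refine Finset.sum_congr rfl fun v _ => ?_
    by_cases hv : v ∈ A
    · simp [y, hv]
    · by_cases hvm : v = m
      · subst hvm
        have : x v = 0 := by simp only [x]; ring
        simp [y, hv, this]
      · rw [hK u hu v hv hvm]; ring
  have hyy : y ⬝ᵥ (S⁻¹ *ᵥ y) = 0 := by
    simp only [dotProduct]
    refine Finset.sum_eq_zero fun u _ => ?_
    by_cases hu : u ∈ A
    · rw [hy u hu]; ring
    · simp [y, hu]
  have hy0 : y = 0 := by
    by_contra hne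
    have := hS.inv.dotProduct_mulVec_pos hne
    simp only [star_trivial] at this
    linarith
  have := congrFun hy0 i
  simp only [y, if_pos hiA, x, Pi.zero_apply] at this
  linarith

theorem quad_two (S : Matrix V V ℝ) {a b : V} (hab : a ≠ b) (s t : ℝ) :
    (Pi.single a s + Pi.single b t : V → ℝ) ⬝ᵥ (S *ᵥ (Pi.single a s + Pi.single b t)) =
      s * S a a * s + s * S a b * t + t * S b a * s + t * S b b * t := by
  simp only [Matrix.mulVec_add, add_dotProduct, dotProduct_add, single_dotProduct,
    Matrix.mulVec_single]
  simp
  ring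

theorem diag_pos' {S : Matrix V V ℝ} (hS : S.PosDef) (a : V) : 0 < S a a := hS.diag_pos

theorem two_lam {S : Matrix V V ℝ} (hS : S.PosDef) {lam : ℝ} (hl : 0 ≤ lam)
    (hm : ∀ x : V → ℝ, lam * (x ⬝ᵥ x) ≤ x ⬝ᵥ (S *ᵥ x)) {a b : V} (hab : a ≠ b) :
    lam * S b b ≤ S a a * S b b - S a b ^ 2 := by
  have h := hm (Pi.single a (S b b) + Pi.single b (- S a b))
  rw [quad_two S hab] at h
  have h1 := quad_two (1 : Matrix V V ℝ) hab (S b b) (- S a b)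
  rw [Matrix.one_mulVec] at h1
  rw [h1] at h
  simp [hab, hab.symm] at h
  rw [sigma_symm hS b a] at h
  have hb := diag_pos' hS b
  have h2 : 0 ≤ lam * (S a b * S a b) := mul_nonneg hl (mul_self_nonneg _)
  have h3 : (lam * S b b) * S b b ≤ (S a a * S b b - S a b ^ 2) * S b b := by nlinarith
  exact le_of_mul_le_mul_right h3 hb

theorem minor_pos {S : Matrix V V ℝ} (hS : S.PosDef) {a b : V} (hab : a ≠ b) :
    S a b ^ 2 < S a a * S b b := by
  have hb := diag_pos' hS b
  have hne : (Pi.single a (S b b) + Pi.single b (- S a b) : V → ℝ) ≠ 0 := by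
    intro h
    have := congrFun h a
    simp [hab] at this
    exact hb.ne' this
  have h := hS.dotProduct_mulVec_pos hne
  simp only [star_trivial] at h
  rw [quad_two S hab, sigma_symm hS b a] at h
  have h3 : 0 < (S a a * S b b - S a b ^ 2) * S b b := by nlinarith
  have := (mul_pos_iff_of_pos_right hb).1 h3
  linarith

theorem two_le {S : Matrix V V ℝ} (hS : S.PosDef) (a b : V) :
    S a b ^ 2 ≤ S a a * S b b := by
  by_cases hab : a = b
  · subst hab; exact (sq _).le
  · exact (minor_pos hS hab).le

theorem adj_ne_s5 {S : Matrix V V ℝ} {G : SimpleGraph V} (hS : S.PosDef)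
    (hC : CondIndepStruct S G) (hG : G.IsTree) {i j : V} (h : G.Adj i j) : S i j ≠ 0 := by
  intro h0
  have hdet : IsUnit S.det := isUnit_iff_ne_zero.2 hS.det_pos.ne'
  have hinv : S⁻¹ * S = 1 := Matrix.nonsing_inv_mul S hdet
  have h1 := congrFun (congrFun hinv i) j
  rw [Matrix.mul_apply, Matrix.one_apply, if_neg h.ne] at h1
  rw [Finset.sum_eq_single j] at h1
  · have hk := (hC i j h.ne).2 h
    exact (mul_ne_zero hk (diag_pos' hS j).ne') h1
  · intro u _ huj
    by_cases hui : u = i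
    · subst hui; rw [h0, mul_zero]
    by_cases hK : S⁻¹ i u = 0
    · rw [hK, zero_mul]
    have hadj := (hC i u (Ne.symm hui)).1 hK
    rcases edge_sep hG hadj j with hs | hs
    · have := hs h.toWalk
      simp [hui, huj] at this
    · have := sep_eq hS hC hs
      rw [h0, mul_zero] at this
      rcases mul_eq_zero.1 this with h2 | h2
      · rw [h2, mul_zero]
      · exact absurd h2 (diag_pos' hS i).ne'
  · simp

theorem ne_path {S : Matrix V V ℝ} {G : SimpleGraph V} (hS : S.PosDef)
    (hC : CondIndepStruct S G) (hG : G.IsTree) {p i : V} (w : G.Walk p i) (hw : w.IsPath) :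
    S p i ≠ 0 := by
  induction w with
  | nil => exact (diag_pos' hS _).ne'
  | @cons p q i h w ih =>
    rw [SimpleGraph.Walk.cons_isPath_iff] at hw
    have hs : SepV G q p i := by
      rcases edge_sep hG h i with hs | hs
      · exact hs
      · exact absurd (hs w) hw.2
    have := sep_eq hS hC hs
    intro h0
    rw [h0, zero_mul] at this
    exact mul_ne_zero (adj_ne_s5 hS hC hG h) (ih hw.1) this.symm

theorem ne_all {S : Matrix V V ℝ} {G : SimpleGraph V} (hS : S.PosDef)
    (hC : CondIndepStruct S G) (hG : G.IsTree) (p i : V) : S p i ≠ 0 := by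
  obtain ⟨w, hw⟩ := hG.connected.exists_isPath p i
  exact ne_path hS hC hG w hw

theorem tri_step {a b c x y z sq : ℝ} (hp : 0 < sq)
    (h1 : a * sq = c * x) (h2 : b * sq = c * y)
    (ih : x * y * z ≤ sq * z ^ 2) : a * b * z * sq ≤ c ^ 2 * z ^ 2 := by
  have h3 : a * b * z * sq * sq = c ^ 2 * (x * y * z) := by
    calc a * b * z * sq * sq = (a * sq) * (b * sq) * z := by ring
      _ = _ := by rw [h1, h2]; ring
  have h4 : c ^ 2 * (x * y * z) ≤ c ^ 2 * (sq * z ^ 2) :=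
    mul_le_mul_of_nonneg_left ih (sq_nonneg c)
  have h5 : (a * b * z * sq) * sq ≤ (c ^ 2 * z ^ 2) * sq := by linarith
  exact le_of_mul_le_mul_right h5 hp

theorem tri_path {S : Matrix V V ℝ} {G : SimpleGraph V} (hS : S.PosDef)
    (hC : CondIndepStruct S G) (hG : G.IsTree) (k : V) {p i : V} (w : G.Walk p i)
    (hw : w.IsPath) : S p i * S p k * S i k ≤ S p p * S i k ^ 2 := by
  induction w with
  | nil => nlinarith
  | @cons p q i h w ih =>
    rw [SimpleGraph.Walk.cons_isPath_iff] at hw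
    have ih := ih hw.1
    have hs : SepV G q p i := by
      rcases edge_sep hG h i with hs | hs
      · exact hs
      · exact absurd (hs w) hw.2
    rcases edge_sep hG h k with hk | hk
    · have hq := diag_pos' hS q
      have h5 := tri_step hq (sep_eq hS hC hs) (sep_eq hS hC hk) ih
      have h6 : S p q ^ 2 * S i k ^ 2 ≤ (S p p * S q q) * S i k ^ 2 :=
        mul_le_mul_of_nonneg_right (two_le hS p q) (sq_nonneg _)
      have h7 : (S p i * S p k * S i k) * S q q ≤ (S p p * S i k ^ 2) * S q q := by linarith
      exact le_of_mul_le_mul_right h7 hq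
    · have hik : SepV G p i k := by
        intro w'
        have := hk (w.append w')
        rw [SimpleGraph.Walk.mem_support_append_iff] at this
        exact this.resolve_left hw.2
      have := sep_eq hS hC hik
      rw [sigma_symm hS i p] at this
      rw [← this]
      apply le_of_eq; ring

theorem tri {S : Matrix V V ℝ} {G : SimpleGraph V} (hS : S.PosDef)
    (hC : CondIndepStruct S G) (hG : G.IsTree) (p i k : V) :
    S p i * S p k * S i k ≤ S p p * S i k ^ 2 := by
  obtain ⟨w, hw⟩ := hG.connected.exists_isPath p i
  exact tri_path hS hC hG k w hw

theorem leaf_nbr {S : Matrix V V ℝ} {G : SimpleGraph V} (hS : S.PosDef)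
    (hC : CondIndepStruct S G) (hG : G.IsTree) (hcard : 3 ≤ Fintype.card V) {b : V}
    (hb : ¬ InternalV G b) : ∃ q, q ≠ b ∧ InternalV G q ∧
      ∀ i k, i ≠ b → k ≠ b → S b i * S b k * S i k * S q q ≤ S b q ^ 2 * S i k ^ 2 := by
  have : Nontrivial V := Fintype.one_lt_card_iff_nontrivial.1 (by omega)
  obtain ⟨q, hq⟩ := hG.connected.preconnected.exists_adj_of_nontrivial b
  have hsep : ∀ i, i ≠ b → SepV G q b i := by
    intro i hi
    rcases edge_sep hG hq i with h | h
    · exact h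
    · exact absurd ⟨q, i, hq.ne', hi, h⟩ hb
  refine ⟨q, hq.ne', ?_, ?_⟩
  · obtain ⟨c, hc⟩ : ∃ c, c ∉ ({b, q} : Finset V) := by
      by_contra hcon
      push Not at hcon
      have h1 : (Finset.univ : Finset V) ⊆ {b, q} := fun x _ => hcon x
      have h2 := Finset.card_le_card h1
      have h3 := Finset.card_le_two (a := b) (b := q)
      rw [Finset.card_univ] at h2
      omega
    simp only [Finset.mem_insert, Finset.mem_singleton, not_or] at hc
    exact ⟨b, c, hq.ne, hc.2, hsep c hc.1⟩
  · intro i k hi hk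
    exact tri_step (diag_pos' hS q) (sep_eq hS hC (hsep i hi))
      (sep_eq hS hC (hsep k hk)) (tri hS hC hG q i k)

theorem internal_ne {G : SimpleGraph V} {b i k : V} (hi : i ≠ b) (h : SepV G b i k) :
    i ≠ k := by
  rintro rfl
  have := h SimpleGraph.Walk.nil
  simp at this
  exact hi this.symm

theorem diag_le {S S' : Matrix V V ℝ} {G G' : SimpleGraph V} (hS : S.PosDef)
    (hC : CondIndepStruct S G) (hG : G.IsTree) (hS' : S'.PosDef)
    (hC' : CondIndepStruct S' G') (hG' : G'.IsTree)
    (hoff : ∀ i j, i ≠ j → S' i j = S i j) {b : V} (hb : InternalV G b) :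
    S b b ≤ S' b b := by
  obtain ⟨i, k, hi, hk, hs⟩ := hb
  have hik := internal_ne hi hs
  have h1 := tri hS' hC' hG' b i k
  rw [hoff _ _ hi.symm, hoff _ _ hk.symm, hoff _ _ hik] at h1
  have h2 := sep_eq hS hC hs
  rw [sigma_symm hS i b] at h2
  rw [← h2] at h1
  have h3 : 0 < S i k ^ 2 := by have := ne_all hS hC hG i k; positivity
  have h4 : S b b * S i k ^ 2 ≤ S' b b * S i k ^ 2 := by linarith
  exact le_of_mul_le_mul_right h4 h3

theorem leaf_bound {S S' : Matrix V V ℝ} {G G' : SimpleGraph V} (hS : S.PosDef)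
    (hC : CondIndepStruct S G) (hG : G.IsTree) (hS' : S'.PosDef)
    (hC' : CondIndepStruct S' G') (hG' : G'.IsTree) (hcard : 3 ≤ Fintype.card V)
    (hoff : ∀ i j, i ≠ j → S' i j = S i j) {b : V} (hb : InternalV G b)
    (hb' : ¬ InternalV G' b) :
    ∃ q, q ≠ b ∧ InternalV G' q ∧ S b b * S' q q ≤ S b q ^ 2 := by
  obtain ⟨i, k, hi, hk, hs⟩ := hb
  obtain ⟨q, hq, hqi, H⟩ := leaf_nbr hS' hC' hG' hcard hb'
  refine ⟨q, hq, hqi, ?_⟩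
  have hik := internal_ne hi hs
  have h1 := H i k hi hk
  rw [hoff _ _ hi.symm, hoff _ _ hk.symm, hoff _ _ hik, hoff _ _ hq.symm] at h1
  have h2 := sep_eq hS hC hs
  rw [sigma_symm hS i b] at h2
  rw [← h2] at h1
  have h3 : 0 < S i k ^ 2 := by have := ne_all hS hC hG i k; positivity
  have h4 : (S b b * S' q q) * S i k ^ 2 ≤ S b q ^ 2 * S i k ^ 2 := by linarith
  exact le_of_mul_le_mul_right h4 h3

theorem adj_of_adj {S S' : Matrix V V ℝ} {G G' : SimpleGraph V} (hS : S.PosDef)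
    (hC : CondIndepStruct S G) (hG : G.IsTree) (hS' : S'.PosDef)
    (hC' : CondIndepStruct S' G') (hG' : G'.IsTree)
    (hoff : ∀ i j, i ≠ j → S' i j = S i j)
    (hint : ∀ b, InternalV G b → S' b b = S b b) {i j : V} (h : G'.Adj i j) : G.Adj i j := by
  by_contra hn
  obtain ⟨m, hmi, hmj, hs⟩ : ∃ m, m ≠ i ∧ m ≠ j ∧ SepV G m i j := by
    obtain ⟨w, hw⟩ := hG.connected.exists_isPath i j
    cases w with
    | nil => exact absurd h (G'.irrefl)
    | @cons _ m _ hm w =>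
      rw [SimpleGraph.Walk.cons_isPath_iff] at hw
      refine ⟨m, hm.ne', fun e => hn (e ▸ hm), ?_⟩
      rcases edge_sep hG hm j with hs | hs
      · exact hs
      · exact absurd (hs w) hw.2
  have h1 := sep_eq hS hC hs
  rw [← hint m ⟨i, j, hmi.symm, hmj.symm, hs⟩, ← hoff _ _ h.ne, ← hoff _ _ hmi.symm,
    ← hoff _ _ hmj] at h1
  have hne := ne_all hS' hC' hG' i j
  rcases edge_sep hG' h m with h2 | h2
  · have h3 := sep_eq hS' hC' h2
    rw [sigma_symm hS' j m] at h3
    have h4 := minor_pos hS' hmj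
    apply h4.ne
    apply mul_left_cancel₀ hne
    linear_combination (-S' m j) * h3 - (S' j j) * h1
  · have h3 := sep_eq hS' hC' h2
    rw [sigma_symm hS' j m, sigma_symm hS' j i] at h3
    have h4 := minor_pos hS' hmi
    rw [sigma_symm hS' m i] at h4
    apply h4.ne
    apply mul_left_cancel₀ hne
    linear_combination (-S' i m) * h3 - (S' i i) * h1

end


theorem stmt_5 {V : Type*} [Fintype V] [DecidableEq V]
    (Tstar : SimpleGraph V) (hTree : Tstar.IsTree) (hcard : 3 ≤ Fintype.card V)
    (Sig : Matrix V V ℝ) (hPD : Sig.PosDef) (hCI : CondIndepStruct Sig Tstar)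
    -- `lam` is the smallest eigenvalue of `Sig`
    (lam : ℝ) (hlam : IsLeast (Set.range hPD.1.eigenvalues) lam)
    (Dstar : Matrix V V ℝ) (hDstar : IsDiagNonneg Dstar)
    (hnoise : ∀ i : V, Dstar i i < lam)
    (Sig' : Matrix V V ℝ) (hPD' : Sig'.PosDef)
    (hmin' : ∀ x : V → ℝ, lam * (x ⬝ᵥ x) ≤ x ⬝ᵥ (Sig' *ᵥ x))
    (D' : Matrix V V ℝ) (hD' : IsDiagNonneg D')
    (hsum : Sig' + D' = Sig + Dstar)
    (T' : SimpleGraph V) (hTree' : T'.IsTree) (hCI' : CondIndepStruct Sig' T') :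
    T' = Tstar := by

  have hoff : ∀ i j, i ≠ j → Sig' i j = Sig i j := by
    intro i j hij
    have := congrFun (congrFun hsum i) j
    simp only [Matrix.add_apply, hD'.1 i j hij, hDstar.1 i j hij] at this
    linarith
  have hoff' : ∀ i j, i ≠ j → Sig i j = Sig' i j := fun i j h => (hoff i j h).symm
  have hdiag : ∀ i, Sig' i i < Sig i i + lam := by
    intro i
    have := congrFun (congrFun hsum i) i
    simp only [Matrix.add_apply] at this
    have h1 := hnoise i
    have h2 := hD'.2 i
    linarith
  have hsub : ∀ b, InternalV Tstar b → InternalV T' b := by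
    intro b hb
    by_contra hb'
    obtain ⟨q, hq, -, h⟩ := leaf_bound hPD hCI hTree hPD' hCI' hTree' hcard hoff hb hb'
    have hl : 0 ≤ lam := (hDstar.2 b).trans (hnoise b).le
    have h2 := two_lam hPD' hl hmin' hq.symm
    rw [hoff _ _ hq.symm] at h2
    have hp := diag_pos' hPD' q
    have h3 := mul_lt_mul_of_pos_right (hdiag b) hp
    linarith
  have heq : ∀ b, InternalV Tstar b → Sig' b b = Sig b b := fun b hb =>
    le_antisymm (diag_le hPD' hCI' hTree' hPD hCI hTree hoff' (hsub b hb))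
      (diag_le hPD hCI hTree hPD' hCI' hTree' hoff hb)
  have hsub' : ∀ b, InternalV T' b → InternalV Tstar b := by
    intro b hb
    by_contra hb'
    obtain ⟨q, hq, hqi, h⟩ := leaf_bound hPD' hCI' hTree' hPD hCI hTree hcard hoff' hb hb'
    rw [← heq q hqi] at h
    exact absurd (minor_pos hPD' hq.symm) (not_lt.2 h)
  ext i j
  constructor
  · exact fun h => adj_of_adj hPD hCI hTree hPD' hCI' hTree' hoff heq h
  · exact fun h => adj_of_adj hPD' hCI' hTree' hPD hCI hTree hoff'
      (fun b hb => (heq b (hsub' b hb)).symm) h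
end

section
/- Let Σ be an n×n positive definite real matrix and let μ be the centered multivariate Gaussian measure on ℝⁿ with covariance matrix Σ. For distinct indices i, j, k, the coordinate functions X_i and X_j are conditionally independent given the σ-algebra generated by the coordinate function X_k (with respect to μ) if and only if Σ_{ij}·Σ_{kk} = Σ_{ik}·Σ_{jk}. -/
open Matrix MeasureTheory
open ProbabilityTheory

/-- shift kernel -/
noncomputable def shiftK (ν : Measure ℝ) (a : ℝ) : Kernel ℝ ℝ :=
  (Kernel.id ×ₖ Kernel.const ℝ ν).map (fun p : ℝ × ℝ => p.2 + a * p.1)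

instance (ν : Measure ℝ) [IsProbabilityMeasure ν] (a : ℝ) : IsMarkovKernel (shiftK ν a) := by
  unfold shiftK
  exact Kernel.IsMarkovKernel.map _ (by fun_prop)

lemma shiftK_apply (ν : Measure ℝ) [IsProbabilityMeasure ν] (a z : ℝ) :
    shiftK ν a z = ν.map (fun u => u + a * z) := by
  unfold shiftK
  rw [Kernel.map_apply _ (by fun_prop), Kernel.prod_apply, Kernel.id_apply, Kernel.const_apply,
    Measure.dirac_prod, Measure.map_map (by fun_prop) (by fun_prop)]
  rfl

lemma compProd_shiftK (ρ ν : Measure ℝ) [IsProbabilityMeasure ρ] [IsProbabilityMeasure ν] (a : ℝ) :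
    ρ ⊗ₘ shiftK ν a = (ρ.prod ν).map (fun p => (p.1, p.2 + a * p.1)) := by
  ext s hs
  rw [Measure.compProd_apply hs, Measure.map_apply (by fun_prop) hs,
    Measure.prod_apply ((show Measurable fun p : ℝ × ℝ => (p.1, p.2 + a * p.1) by fun_prop) hs)]
  congr 1; ext z
  rw [shiftK_apply, Measure.map_apply (by fun_prop) (measurable_prodMk_left hs)]
  rfl

lemma comp_shiftK (ρ ν₁ ν₂ : Measure ℝ) [IsProbabilityMeasure ρ] [IsProbabilityMeasure ν₁]
    [IsProbabilityMeasure ν₂] (a b : ℝ) :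
    ρ ⊗ₘ (shiftK ν₁ a ×ₖ shiftK ν₂ b) = (ρ.prod (ν₁.prod ν₂)).map
      (fun p : ℝ × ℝ × ℝ => (p.1, p.2.1 + a * p.1, p.2.2 + b * p.1)) := by
  ext s hs
  rw [Measure.compProd_apply hs, Measure.map_apply (by fun_prop) hs,
    Measure.prod_apply ((show Measurable fun p : ℝ × ℝ × ℝ =>
      (p.1, p.2.1 + a * p.1, p.2.2 + b * p.1) by fun_prop) hs)]
  congr 1; ext z
  rw [Kernel.prod_apply, shiftK_apply, shiftK_apply,
    Measure.map_prod_map _ _ (by fun_prop) (by fun_prop),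
    Measure.map_apply (by fun_prop) (measurable_prodMk_left hs)]
  rfl

lemma condDistrib_shift {Ω : Type*} [MeasurableSpace Ω] {μ : Measure Ω} [IsProbabilityMeasure μ]
    {X Z : Ω → ℝ} (hX : Measurable X) (hZ : Measurable Z) (a : ℝ)
    (h : IndepFun Z (fun ω => X ω - a * Z ω) μ) :
    condDistrib X Z μ =ᵐ[μ.map Z] shiftK (μ.map (fun ω => X ω - a * Z ω)) a := by
  have := Measure.isProbabilityMeasure_map (μ := μ) hZ.aemeasurable
  have := Measure.isProbabilityMeasure_map (μ := μ) (f := fun ω => X ω - a * Z ω)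
    (by fun_prop)
  rw [condDistrib_ae_eq_iff_measure_eq_compProd _ hX.aemeasurable, compProd_shiftK,
    ← (indepFun_iff_map_prod_eq_prod_map_map (by fun_prop) (by fun_prop)).1 h,
    Measure.map_map (by fun_prop) (by fun_prop)]
  congr 1; ext ω <;> simp

lemma condIndepFun_iff_shift {Ω : Type*} [MeasurableSpace Ω] [StandardBorelSpace Ω]
    {μ : Measure Ω} [IsProbabilityMeasure μ]
    {X Y Z : Ω → ℝ} (hX : Measurable X) (hY : Measurable Y) (hZ : Measurable Z) (a b : ℝ)
    (hU : IndepFun Z (fun ω => X ω - a * Z ω) μ) (hV : IndepFun Z (fun ω => Y ω - b * Z ω) μ) :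
    CondIndepFun (MeasurableSpace.comap Z inferInstance) hZ.comap_le X Y μ ↔
     μ.map (fun ω => (Z ω, X ω - a * Z ω, Y ω - b * Z ω)) = (μ.map Z).prod
      ((μ.map (fun ω => X ω - a * Z ω)).prod (μ.map (fun ω => Y ω - b * Z ω))) := by
  have := Measure.isProbabilityMeasure_map (μ := μ) hZ.aemeasurable
  have := Measure.isProbabilityMeasure_map (μ := μ) (f := fun ω => X ω - a * Z ω)
    (by fun_prop)
  have := Measure.isProbabilityMeasure_map (μ := μ) (f := fun ω => Y ω - b * Z ω)
    (by fun_prop)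
  have key : μ.map Z ⊗ₘ (condDistrib X Z μ ×ₖ condDistrib Y Z μ) =
      μ.map Z ⊗ₘ (shiftK (μ.map (fun ω => X ω - a * Z ω)) a ×ₖ
        shiftK (μ.map (fun ω => Y ω - b * Z ω)) b) := by
    apply Measure.compProd_congr
    filter_upwards [condDistrib_shift hX hZ a hU, condDistrib_shift hY hZ b hV] with z h1 h2
    rw [Kernel.prod_apply, Kernel.prod_apply, h1, h2]
  rw [condIndepFun_iff_map_prod_eq_prod_condDistrib_prod_condDistrib hX hY hZ,
    ← Measure.compProd_eq_comp_prod, key, comp_shiftK]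
  constructor
  · intro h
    have h2 := congrArg (Measure.map
      (fun p : ℝ × ℝ × ℝ => (p.1, p.2.1 - a * p.1, p.2.2 - b * p.1))) h
    rw [Measure.map_map (by fun_prop) (by fun_prop), Measure.map_map (by fun_prop) (by fun_prop)]
      at h2
    refine Eq.trans h2 ?_
    have hid : ((fun p : ℝ × ℝ × ℝ => (p.1, p.2.1 - a * p.1, p.2.2 - b * p.1)) ∘
        fun p : ℝ × ℝ × ℝ => (p.1, p.2.1 + a * p.1, p.2.2 + b * p.1)) = id := by
      ext p <;> simp
    rw [hid, Measure.map_id]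
  · intro h
    rw [← h, Measure.map_map (by fun_prop) (by fun_prop)]
    congr 1; ext ω <;> simp

lemma condIndepFun_iff_cov {Ω : Type*} [MeasurableSpace Ω] [StandardBorelSpace Ω]
    {μ : Measure Ω} [IsProbabilityMeasure μ]
    {X Y Z : Ω → ℝ} (hX : Measurable X) (hY : Measurable Y) (hZ : Measurable Z)
    (hG : HasGaussianLaw (fun ω => (Z ω, X ω, Y ω)) μ) (hz : cov[Z, Z; μ] ≠ 0) :
    CondIndepFun (MeasurableSpace.comap Z inferInstance) hZ.comap_le X Y μ ↔
      cov[X, Y; μ] * cov[Z, Z; μ] = cov[X, Z; μ] * cov[Y, Z; μ] := by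
  set a := cov[X, Z; μ] / cov[Z, Z; μ] with ha
  set b := cov[Y, Z; μ] / cov[Z, Z; μ] with hb
  let T : ℝ × ℝ × ℝ →L[ℝ] ℝ × ℝ × ℝ :=
    (ContinuousLinearMap.fst ℝ ℝ (ℝ × ℝ)).prod
     (((ContinuousLinearMap.fst ℝ ℝ ℝ).comp (ContinuousLinearMap.snd ℝ ℝ (ℝ × ℝ)) -
        a • ContinuousLinearMap.fst ℝ ℝ (ℝ × ℝ)).prod
      ((ContinuousLinearMap.snd ℝ ℝ ℝ).comp (ContinuousLinearMap.snd ℝ ℝ (ℝ × ℝ)) -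
        b • ContinuousLinearMap.fst ℝ ℝ (ℝ × ℝ)))
  have hG' : HasGaussianLaw (fun ω => (Z ω, X ω - a * Z ω, Y ω - b * Z ω)) μ := hG.map_fun T
  have mZ : MemLp Z 2 μ := hG.fst.memLp_two
  have mX : MemLp X 2 μ := hG.snd.fst.memLp_two
  have mY : MemLp Y 2 μ := hG.snd.snd.memLp_two
  have maZ : MemLp (fun ω => a * Z ω) 2 μ := mZ.const_mul a
  have mbZ : MemLp (fun ω => b * Z ω) 2 μ := mZ.const_mul b
  have mU : MemLp (fun ω => X ω - a * Z ω) 2 μ := hG'.snd.fst.memLp_two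
  have mV : MemLp (fun ω => Y ω - b * Z ω) 2 μ := hG'.snd.snd.memLp_two
  have cU : cov[Z, fun ω => X ω - a * Z ω; μ] = 0 := by
    rw [covariance_fun_sub_right mZ mX maZ, covariance_const_mul_right, ha,
      covariance_comm Z X]
    field_simp; ring
  have cV : cov[Z, fun ω => Y ω - b * Z ω; μ] = 0 := by
    rw [covariance_fun_sub_right mZ mY mbZ, covariance_const_mul_right, hb,
      covariance_comm Z Y]
    field_simp; ring
  have cUV : cov[fun ω => X ω - a * Z ω, fun ω => Y ω - b * Z ω; μ] =
      cov[X, Y; μ] - cov[X, Z; μ] * cov[Y, Z; μ] / cov[Z, Z; μ] := by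
    rw [covariance_fun_sub_left mX maZ mV, covariance_const_mul_left, cV,
      covariance_fun_sub_right mX mY mbZ, covariance_const_mul_right, hb]
    field_simp; ring
  have iU : IndepFun Z (fun ω => X ω - a * Z ω) μ :=
    HasGaussianLaw.indepFun_of_covariance_eq_zero
      (hG'.map_fun ((ContinuousLinearMap.fst ℝ ℝ (ℝ × ℝ)).prod
       ((ContinuousLinearMap.fst ℝ ℝ ℝ).comp (ContinuousLinearMap.snd ℝ ℝ (ℝ × ℝ))))) cU
  have iV : IndepFun Z (fun ω => Y ω - b * Z ω) μ :=
    HasGaussianLaw.indepFun_of_covariance_eq_zero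
      (hG'.map_fun ((ContinuousLinearMap.fst ℝ ℝ (ℝ × ℝ)).prod
       ((ContinuousLinearMap.snd ℝ ℝ ℝ).comp (ContinuousLinearMap.snd ℝ ℝ (ℝ × ℝ))))) cV
  have := Measure.isProbabilityMeasure_map (μ := μ) hZ.aemeasurable
  rw [condIndepFun_iff_shift hX hY hZ a b iU iV]
  have e : (cov[X, Y; μ] * cov[Z, Z; μ] = cov[X, Z; μ] * cov[Y, Z; μ]) ↔
      cov[fun ω => X ω - a * Z ω, fun ω => Y ω - b * Z ω; μ] = 0 := by
    rw [cUV, sub_eq_zero, eq_div_iff hz]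
  rw [e]
  constructor
  · intro h
    apply IndepFun.covariance_eq_zero _ mU mV
    rw [indepFun_iff_map_prod_eq_prod_map_map (by fun_prop) (by fun_prop)]
    have h2 := congrArg (Measure.map Prod.snd) h
    rw [Measure.map_map (by fun_prop) (by fun_prop), Measure.map_snd_prod, measure_univ,
      one_smul] at h2
    exact h2
  · intro h
    have iUV := HasGaussianLaw.indepFun_of_covariance_eq_zero hG'.snd h
    rw [indepFun_iff_map_prod_eq_prod_map_map (by fun_prop) (by fun_prop)] at iUV
    rw [← iUV, ← indepFun_iff_map_prod_eq_prod_map_map (by fun_prop) (by fun_prop)]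
    apply hG'.indepFun_of_covariance_strongDual
    intro L₁ L₂
    have e1 : ⇑L₁ ∘ Z = fun ω => L₁ 1 * Z ω := by
      ext ω
      have := L₁.map_smul (Z ω) 1
      simp at this; simp [this, mul_comm]
    have e2 : (⇑L₂ ∘ fun ω => (X ω - a * Z ω, Y ω - b * Z ω)) =
        fun ω => L₂ (1, 0) * (X ω - a * Z ω) + L₂ (0, 1) * (Y ω - b * Z ω) := by
      ext ω
      have h1 := L₂.map_smul (X ω - a * Z ω) (1, 0)
      have h2 := L₂.map_smul (Y ω - b * Z ω) (0, 1)
      have h3 := L₂.map_add ((X ω - a * Z ω) • (1, 0)) ((Y ω - b * Z ω) • (0, 1))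
      rw [h1, h2] at h3
      simp at h3
      simp only [Function.comp_apply, h3]
      ring
    have e3 : (fun ω => L₂ (1, 0) * (X ω - a * Z ω) + L₂ (0, 1) * (Y ω - b * Z ω)) =
        (fun ω => L₂ (1, 0) * (X ω - a * Z ω)) + (fun ω => L₂ (0, 1) * (Y ω - b * Z ω)) := rfl
    rw [e1, e2, e3, covariance_const_mul_left, covariance_add_right mZ (mU.const_mul _)
      (mV.const_mul _), covariance_const_mul_right, covariance_const_mul_right, cU, cV]
    simp

lemma pi_gaussian_eq (n : ℕ) :
    Measure.pi (fun _ : Fin n => gaussianReal 0 1) =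
      (volume : Measure (Fin n → ℝ)).withDensity
        (fun x => ENNReal.ofReal (∏ i, gaussianPDFReal 0 1 (x i))) := by
  apply Measure.pi_eq
  intro s hs
  have hI : ∀ i, Integrable ((s i).indicator (gaussianPDFReal 0 1)) volume := fun i =>
    (integrable_gaussianPDFReal 0 1).indicator (hs i)
  have hn : ∀ i x, 0 ≤ (s i).indicator (gaussianPDFReal 0 1) x := fun i x =>
    Set.indicator_nonneg (fun _ _ => gaussianPDFReal_nonneg 0 1 _) x
  rw [withDensity_apply _ (MeasurableSet.univ_pi hs), ← lintegral_indicator (MeasurableSet.univ_pi hs)]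
  have : ((Set.univ.pi s).indicator
      (fun x : Fin n → ℝ => ENNReal.ofReal (∏ i, gaussianPDFReal 0 1 (x i)))) =
      fun x => ENNReal.ofReal (∏ i, (s i).indicator (gaussianPDFReal 0 1) (x i)) := by
    ext x
    by_cases hx : x ∈ Set.univ.pi s
    · rw [Set.indicator_of_mem hx]
      congr 1
      refine Finset.prod_congr rfl fun i _ => ?_
      rw [Set.indicator_of_mem (hx i trivial)]
    · rw [Set.indicator_of_notMem hx]
      simp only [Set.mem_pi, Set.mem_univ, true_imp_iff, not_forall] at hx
      obtain ⟨i, hi⟩ := hx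
      rw [Finset.prod_eq_zero (Finset.mem_univ i) (Set.indicator_of_notMem hi _)]
      simp
  have hP : Integrable (fun x : Fin n → ℝ => ∏ i, (s i).indicator (gaussianPDFReal 0 1) (x i))
      volume := Integrable.fintype_prod hI
  rw [this, ← ofReal_integral_eq_lintegral_ofReal hP
    (Filter.Eventually.of_forall fun x => Finset.prod_nonneg fun i _ => hn i _),
    integral_fintype_prod_volume_eq_prod,
    ENNReal.ofReal_prod_of_nonneg (fun i _ => integral_nonneg (hn i))]
  refine Finset.prod_congr rfl fun i _ => ?_
  rw [gaussianReal_apply_eq_integral _ one_ne_zero, integral_indicator (hs i)]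

lemma pdf_prod {n : ℕ} (x : Fin n → ℝ) : ∏ i, gaussianPDFReal 0 1 (x i) =
    (√(2 * Real.pi))⁻¹ ^ n * Real.exp (-(x ⬝ᵥ x) / 2) := by
  simp [gaussianPDFReal, Finset.prod_mul_distrib, ← Real.exp_sum, dotProduct, Finset.sum_div,
    neg_div, pow_two]

open scoped MatrixOrder in
lemma map_eq_multivariate {n : ℕ}
    (Sig : Matrix (Fin n) (Fin n) ℝ) (hPD : Sig.PosDef)
    (μ : Measure (Fin n → ℝ)) [IsProbabilityMeasure μ]
    (hμ : ∃ Z : ℝ, 0 < Z ∧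
      μ = volume.withDensity
        (fun x : Fin n → ℝ => ENNReal.ofReal (Z * Real.exp (-(x ⬝ᵥ (Sig⁻¹ *ᵥ x)) / 2)))) :
    μ.map (WithLp.toLp 2) = multivariateGaussian 0 Sig := by
  obtain ⟨Z, hZ, hμ⟩ := hμ
  set A := CFC.sqrt Sig with hA
  have hAA : A * A = Sig := CFC.sqrt_mul_sqrt_self _ hPD.posSemidef.nonneg
  have hAs : Aᵀ = A := by
    have := (CFC.sqrt_nonneg Sig).isSelfAdjoint
    rw [← conjTranspose_eq_transpose_of_trivial]; exact this
  have hdS : Sig.det ≠ 0 := hPD.det_pos.ne'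
  have hd : A.det ≠ 0 := by
    intro h; apply hdS; rw [← hAA, det_mul, h, zero_mul]
  have hq : ∀ y, (A *ᵥ y) ⬝ᵥ (Sig⁻¹ *ᵥ (A *ᵥ y)) = y ⬝ᵥ y := by
    intro y
    have : A * (Sig⁻¹ * A) = 1 := by
      rw [← hAA, Matrix.mul_inv_rev, Matrix.mul_assoc, Matrix.nonsing_inv_mul _ hd.isUnit,
       Matrix.mul_one, Matrix.mul_nonsing_inv _ hd.isUnit]
    rw [mulVec_mulVec, dotProduct_comm, dotProduct_mulVec, ← mulVec_transpose, hAs, mulVec_mulVec,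
      this, one_mulVec]
  have hm : Measurable (fun y : Fin n → ℝ => A *ᵥ y) := by
    have : Continuous (fun y : Fin n → ℝ => A *ᵥ y) := by fun_prop
    exact this.measurable
  -- the map of the standard Gaussian
  set c : ℝ := (√(2 * Real.pi))⁻¹ ^ n with hc
  have hc0 : 0 < c := by positivity
  have hvol : (volume : Measure (Fin n → ℝ)).map (fun y => A *ᵥ y) =
      ENNReal.ofReal (abs (det A)⁻¹) • volume := Real.map_matrix_volume_pi_eq_smul_volume_pi hd
  set f : (Fin n → ℝ) → ENNReal := (fun x : Fin n → ℝ => ENNReal.ofReal (Z * Real.exp (-(x ⬝ᵥ (Sig⁻¹ *ᵥ x)) / 2))) with hf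
  have hfm : Measurable f := by
    have : Continuous f := by
      unfold f
      refine ENNReal.continuous_ofReal.comp ?_
      fun_prop
    exact this.measurable
  obtain ⟨r, hr⟩ : ∃ r : ENNReal, (Measure.pi (fun _ : Fin n => gaussianReal 0 1)).map
      (fun y => A *ᵥ y) = r • μ := by
    refine ⟨ENNReal.ofReal (c / Z) * ENNReal.ofReal (abs (det A)⁻¹), ?_⟩
    ext s hs
    rw [Measure.map_apply hm hs, pi_gaussian_eq, withDensity_apply _ (hm hs), Measure.smul_apply,
      hμ, withDensity_apply _ hs, smul_eq_mul, mul_assoc, ← smul_eq_mul (a := ENNReal.ofReal |_|),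
      ← lintegral_smul_measure, ← Measure.restrict_smul, ← hvol, setLIntegral_map hs hfm hm,
      ← lintegral_const_mul _ (show Measurable fun x => f (A *ᵥ x) from hfm.comp hm)]
    congr 1; ext y
    rw [hf, pdf_prod, ← ENNReal.ofReal_mul (by positivity)]
    simp only [hq]
    congr 1
    field_simp
    rw [hc, one_div]
  have hr1 : r = 1 := by
    have h1 := congrArg (fun m => m Set.univ) hr
    simp only [Measure.smul_apply, measure_univ, smul_eq_mul, mul_one] at h1
    rw [← h1, Measure.map_apply hm MeasurableSet.univ]; simp
  rw [hr1, one_smul] at hr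
  rw [← hr, multivariateGaussian, ← map_pi_eq_stdGaussian, Measure.map_map (by fun_prop) hm,
    Measure.map_map (by fun_prop) (by fun_prop)]
  congr 1; ext y i
  simp [hA]

theorem gauss_props {n : ℕ}
    (Sig : Matrix (Fin n) (Fin n) ℝ) (hPD : Sig.PosDef)
    (μ : Measure (Fin n → ℝ)) [IsProbabilityMeasure μ]
    (hμ : ∃ Z : ℝ, 0 < Z ∧
      μ = volume.withDensity
        (fun x : Fin n → ℝ => ENNReal.ofReal (Z * Real.exp (-(x ⬝ᵥ (Sig⁻¹ *ᵥ x)) / 2)))) :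
    HasGaussianLaw (fun x : Fin n → ℝ => x) μ ∧
      ∀ i j, cov[fun x => x i, fun x => x j; μ] = Sig i j := by
  have h := map_eq_multivariate Sig hPD μ hμ
  constructor
  · have h1 : HasGaussianLaw (WithLp.toLp 2 : (Fin n → ℝ) → EuclideanSpace ℝ (Fin n)) μ :=
      ⟨by rw [h]; infer_instance⟩
    exact h1.map_equiv_fun (PiLp.continuousLinearEquiv 2 ℝ (fun _ : Fin n => ℝ))
  · intro i j
    rw [← covariance_eval_multivariateGaussian (μ := 0) hPD.posSemidef i j, ← h,
      covariance_map (Measurable.aestronglyMeasurable (by fun_prop))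
        (Measurable.aestronglyMeasurable (by fun_prop)) (by fun_prop)]
    rfl

theorem stmt_10 {n : ℕ}
    (Sig : Matrix (Fin n) (Fin n) ℝ) (hPD : Sig.PosDef)
    -- `μ` is the centered multivariate Gaussian measure with covariance `Sig`:
    -- a probability measure with density proportional to `exp (- xᵀ Σ⁻¹ x / 2)`
    (μ : Measure (Fin n → ℝ)) [IsProbabilityMeasure μ]
    (hμ : ∃ Z : ℝ, 0 < Z ∧
      μ = volume.withDensity
        (fun x : Fin n → ℝ => ENNReal.ofReal (Z * Real.exp (-(x ⬝ᵥ (Sig⁻¹ *ᵥ x)) / 2))))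
    (i j k : Fin n) (hij : i ≠ j) (hik : i ≠ k) (hjk : j ≠ k) :
    ProbabilityTheory.CondIndepFun
        (MeasurableSpace.comap (fun x : Fin n → ℝ => x k) inferInstance)
        (measurable_pi_apply k).comap_le
        (fun x : Fin n → ℝ => x i) (fun x : Fin n → ℝ => x j) μ ↔
      Sig i j * Sig k k = Sig i k * Sig j k := by
  obtain ⟨hG, hcov⟩ := gauss_props Sig hPD μ hμ
  have hG3 : HasGaussianLaw (fun x : Fin n → ℝ => (x k, x i, x j)) μ :=
    hG.map_fun ((ContinuousLinearMap.proj (R := ℝ) (φ := fun _ : Fin n => ℝ) k).prod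
      ((ContinuousLinearMap.proj (R := ℝ) (φ := fun _ : Fin n => ℝ) i).prod
        (ContinuousLinearMap.proj (R := ℝ) (φ := fun _ : Fin n => ℝ) j)))
  have hz : cov[fun x : Fin n → ℝ => x k, fun x => x k; μ] ≠ 0 := by
    rw [hcov]; exact hPD.diag_pos.ne'
  rw [condIndepFun_iff_cov (measurable_pi_apply i) (measurable_pi_apply j) (measurable_pi_apply k)
    hG3 hz, hcov, hcov, hcov, hcov]
end
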